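/- For every integer d ≥ 3 there exist a full-dimensional integral polytope P ⊆ ℝ^d and a polynomial p of degree d with rational coefficients and constant coefficient 1 such that i(P,t) = p(t) for every positive integer t, the coefficient of t^{d−2} in p is positive, and the coefficient of t^j in p is negative for every j with 1 ≤ j < d−2. -/

import Mathlib

open scoped Pointwise BigOperators

/-- `P` is an integral polytope: the convex hull of finitely many points
with integer coordinates. -/
def IsIntegralPolytope {N : ℕ} (P : Set (Fin N → ℝ)) : Prop :=
  ∃ V : Finset (Fin N → ℝ),
    (∀ v ∈ V, ∀ i, ∃ z : ℤ, v i = (z : ℝ)) ∧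
    P = convexHull ℝ (V : Set (Fin N → ℝ))

/-- `latticeCount P t = i(P,t)`: the number of points of `ℤ^N` in the dilate `t • P`. -/
noncomputable def latticeCount {N : ℕ} (P : Set (Fin N → ℝ)) (t : ℕ) : ℕ :=
  Set.ncard {x : Fin N → ℝ | x ∈ (t : ℝ) • P ∧ ∀ i, ∃ z : ℤ, x i = (z : ℝ)}

open Polynomial

/-- `P` is an integral polytope with nonempty interior and Ehrhart polynomial `p`. -/
structure HasEhrhartPolynomial {N : ℕ} (P : Set (Fin N → ℝ)) (p : ℚ[X]) : Prop where
  integral : IsIntegralPolytope P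
  interior_nonempty : (interior P).Nonempty
  count : ∀ t : ℕ, 0 < t → (latticeCount P t : ℚ) = p.eval (t : ℚ)

/-- The prism `[0, a] × P`. -/
def prism {N : ℕ} (a : ℕ) (P : Set (Fin N → ℝ)) : Set (Fin (N + 1) → ℝ) :=
  {x | x 0 ∈ Set.Icc (0 : ℝ) a ∧ Fin.tail x ∈ P}

theorem isIntegralPolytope_prism {N : ℕ} (a : ℕ) {P : Set (Fin N → ℝ)}
    (hP : IsIntegralPolytope P) : IsIntegralPolytope (prism a P) := by
  classical
  obtain ⟨V, hV, rfl⟩ := hP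
  let e := Fin.consLinearEquiv ℝ (fun _ : Fin (N + 1) => ℝ)
  refine ⟨(({0, (a : ℝ)} : Finset ℝ) ×ˢ V).image e, ?_, ?_⟩
  · simp only [Finset.mem_image, Finset.mem_product, Prod.exists]
    rintro _ ⟨c, v, ⟨hc, hv⟩, rfl⟩ i
    refine Fin.cases ?_ (fun j => ?_) i
    · rcases Finset.mem_insert.1 hc with rfl | hc
      · exact ⟨0, by simp [e, Fin.consLinearEquiv]⟩
      · exact ⟨a, by simpa [e, Fin.consLinearEquiv] using hc⟩
    · simpa [e, Fin.consLinearEquiv] using hV v hv j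
  · have h := LinearMap.image_convexHull (e : (ℝ × (Fin N → ℝ)) →ₗ[ℝ] (Fin (N + 1) → ℝ))
      (({0, (a : ℝ)} : Set ℝ) ×ˢ (V : Set (Fin N → ℝ)))
    rw [convexHull_prod, convexHull_pair, segment_eq_Icc (Nat.cast_nonneg a)] at h
    rw [Finset.coe_image, Finset.coe_product, Finset.coe_pair]
    refine Eq.trans ?_ h
    ext x
    simp only [prism, Set.mem_ofPred_eq, Set.mem_image, Set.mem_prod]
    constructor
    · rintro ⟨h0, h1⟩
      exact ⟨(x 0, Fin.tail x), ⟨h0, h1⟩, Fin.cons_self_tail x⟩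
    · rintro ⟨⟨c, v⟩, ⟨h0, h1⟩, rfl⟩
      exact ⟨h0, h1⟩

theorem interior_prism_nonempty {N : ℕ} {a : ℕ} (ha : 0 < a) {P : Set (Fin N → ℝ)}
    (hP : (interior P).Nonempty) : (interior (prism a P)).Nonempty := by
  obtain ⟨v, hv⟩ := hP
  have ha' : (0 : ℝ) < a := Nat.cast_pos.2 ha
  refine ⟨Fin.cons ((a : ℝ) / 2) v, mem_interior.2
    ⟨{x | x 0 ∈ Set.Ioo (0 : ℝ) a ∧ Fin.tail x ∈ interior P}, ?_, ?_, ?_⟩⟩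
  · exact fun x hx => ⟨Set.Ioo_subset_Icc_self hx.1, interior_subset hx.2⟩
  · refine (isOpen_Ioo.preimage (continuous_apply 0)).inter (isOpen_interior.preimage ?_)
    exact continuous_pi fun i => continuous_apply i.succ
  · refine ⟨?_, by simpa using hv⟩
    simp only [Fin.cons_zero]
    constructor <;> linarith

theorem ncard_integer_points_Icc (b : ℕ) :
    {c : ℝ | c ∈ Set.Icc (0 : ℝ) b ∧ ∃ z : ℤ, c = z}.ncard = b + 1 := by
  have h : {c : ℝ | c ∈ Set.Icc (0 : ℝ) b ∧ ∃ z : ℤ, c = z} =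
      (Nat.cast : ℕ → ℝ) '' (Finset.range (b + 1) : Finset ℕ) := by
    ext c
    simp only [Set.mem_ofPred_eq, Set.mem_Icc, Set.mem_image, Finset.coe_range, Set.mem_Iio]
    constructor
    · rintro ⟨⟨h0, h1⟩, z, rfl⟩
      lift z to ℕ using by exact_mod_cast h0
      exact ⟨z, Nat.lt_succ_of_le (by exact_mod_cast h1), by simp⟩
    · rintro ⟨k, hk, rfl⟩
      exact ⟨⟨Nat.cast_nonneg k, by exact_mod_cast Nat.lt_succ_iff.1 hk⟩, k, by simp⟩
  rw [h, Set.ncard_image_of_injective _ Nat.cast_injective, Set.ncard_coe_finset,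
    Finset.card_range]

theorem latticeCount_prism {N : ℕ} (a : ℕ) (P : Set (Fin N → ℝ)) {t : ℕ} (ht : 0 < t) :
    latticeCount (prism a P) t = (a * t + 1) * latticeCount P t := by
  have ht' : (0 : ℝ) < t := Nat.cast_pos.2 ht
  rw [latticeCount, latticeCount, ← ncard_integer_points_Icc (a * t), ← Set.ncard_prod,
    ← Set.ncard_image_of_injective _ (Fin.consEquiv (fun _ : Fin (N + 1) => ℝ)).injective]
  congr 1
  have key (y : ℝ) : (t : ℝ)⁻¹ * y ∈ Set.Icc (0 : ℝ) a ↔ y ∈ Set.Icc (0 : ℝ) ((a * t : ℕ) : ℝ) := by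
    rw [Set.mem_Icc, Set.mem_Icc, inv_mul_le_iff₀ ht', Nat.cast_mul, mul_comm (t : ℝ) a,
      mul_nonneg_iff_of_pos_left (inv_pos.2 ht')]
  ext x
  simp only [Set.mem_image, Set.mem_prod, Set.mem_ofPred_eq,
    Set.mem_smul_set_iff_inv_smul_mem₀ ht'.ne', prism, Pi.smul_apply, smul_eq_mul, key]
  constructor
  · rintro ⟨⟨h0, h1⟩, hz⟩
    exact ⟨(x 0, Fin.tail x), ⟨⟨h0, hz 0⟩, h1, fun i => hz i.succ⟩, Fin.cons_self_tail x⟩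
  · rintro ⟨⟨c, v⟩, ⟨⟨h0, hc⟩, h1, hv⟩, rfl⟩
    exact ⟨⟨h0, h1⟩, Fin.cases hc hv⟩

theorem HasEhrhartPolynomial.prism {N : ℕ} {a : ℕ} (ha : 0 < a) {P : Set (Fin N → ℝ)} {p : ℚ[X]}
    (h : HasEhrhartPolynomial P p) : HasEhrhartPolynomial (prism a P) (p * (C (a : ℚ) * X + 1)) where
  integral := isIntegralPolytope_prism a h.integral
  interior_nonempty := interior_prism_nonempty ha h.interior_nonempty
  count t ht := by
    rw [latticeCount_prism a P ht, Nat.cast_mul, h.count t ht]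
    simp [mul_comm]

theorem HasEhrhartPolynomial.exists_mul_pow {N : ℕ} {a : ℕ} (ha : 0 < a) {P : Set (Fin N → ℝ)}
    {p : ℚ[X]} (h : HasEhrhartPolynomial P p) (n : ℕ) :
    ∃ Q : Set (Fin (N + n) → ℝ), HasEhrhartPolynomial Q (p * (C (a : ℚ) * X + 1) ^ n) := by
  induction n with
  | zero => exact ⟨P, by simpa using h⟩
  | succ n ih =>
    obtain ⟨Q, hQ⟩ := ih
    exact ⟨_, by simpa only [pow_succ, mul_assoc] using hQ.prism ha⟩

/-- The Reeve tetrahedron with vertices `0`, `(s, 0, 0)`, `(0, s, 0)`, `(s, s, s * m)`. -/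
def reeve (m : ℕ) (s : ℝ) : Set (Fin 3 → ℝ) :=
  {x | 0 ≤ x 2 ∧ m * (x 0 + x 1 - s) ≤ x 2 ∧ x 2 ≤ m * x 0 ∧ x 2 ≤ m * x 1}

theorem isIntegralPolytope_reeve {m s : ℕ} (hm : 0 < m) (hs : 0 < s) :
    IsIntegralPolytope (reeve m s) := by
  classical
  have hm' : (0 : ℝ) < m := Nat.cast_pos.2 hm
  have hs' : (0 : ℝ) < s := Nat.cast_pos.2 hs
  let v : Fin 4 → Fin 3 → ℝ := ![0, ![s, 0, 0], ![0, s, 0], ![s, s, s * m]]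
  refine ⟨Finset.univ.image v, ?_, ?_⟩
  · simp only [Finset.mem_image, Finset.mem_univ, true_and, forall_exists_index,
      forall_apply_eq_imp_iff]
    have hv (i : Fin 4) (j : Fin 3) : ∃ k : ℕ, v i j = k := by
      fin_cases i <;> fin_cases j <;> simp [v] <;>
        first
        | exact ⟨0, Nat.cast_zero.symm⟩
        | exact ⟨s * m, (Nat.cast_mul s m).symm⟩
    intro i j
    obtain ⟨k, hk⟩ := hv i j
    exact ⟨k, by simpa using hk⟩
  · refine subset_antisymm (fun x hx => ?_) (convexHull_min ?_ ?_)
    · obtain ⟨h0, h1, h2, h3⟩ := hx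
      have hw := (convex_convexHull ℝ ((Finset.univ.image v : Finset _) : Set (Fin 3 → ℝ))).sum_mem
        (t := Finset.univ) (z := v)
        (w := ![(s - x 0 - x 1 + x 2 / m) / s, (x 0 - x 2 / m) / s, (x 1 - x 2 / m) / s,
          x 2 / m / s]) ?_ ?_ ?_
      · convert hw using 1
        ext i
        fin_cases i <;> simp [Fin.sum_univ_four, v] <;> field_simp <;> ring
      · have a0 : 0 ≤ x 2 / m := by positivity
        have a1 : x 0 + x 1 - s ≤ x 2 / m := by rw [le_div_iff₀ hm']; linarith
        have a2 : x 2 / m ≤ x 0 := by rw [div_le_iff₀ hm']; linarith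
        have a3 : x 2 / m ≤ x 1 := by rw [div_le_iff₀ hm']; linarith
        intro i _
        fin_cases i <;> simp <;> refine div_nonneg ?_ hs'.le <;> linarith
      · simp [Fin.sum_univ_four]
        field_simp
        ring
      · exact fun i _ => subset_convexHull ℝ _ (by simp)
    · simp only [Finset.coe_image, Finset.coe_univ, Set.image_univ]
      rintro _ ⟨i, rfl⟩
      fin_cases i <;> simp [v, reeve, mul_comm (s : ℝ) m] <;> positivity
    · rintro x ⟨h0, h1, h2, h3⟩ y ⟨k0, k1, k2, k3⟩ a b ha hb hab
      have hb' : b = 1 - a := by linarith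
      subst hb'
      simp only [reeve, Set.mem_ofPred_eq, Pi.add_apply, Pi.smul_apply, smul_eq_mul]
      refine ⟨by positivity, ?_, ?_, ?_⟩ <;> nlinarith

theorem interior_reeve_nonempty {m s : ℕ} (hm : 0 < m) (hs : 0 < s) :
    (interior (reeve m s)).Nonempty := by
  have hm' : (0 : ℝ) < m := Nat.cast_pos.2 hm
  have hs' : (0 : ℝ) < s := Nat.cast_pos.2 hs
  refine ⟨![s / 2, s / 2, m * (s / 4)], mem_interior.2
    ⟨{x | 0 < x 2 ∧ m * (x 0 + x 1 - s) < x 2 ∧ x 2 < m * x 0 ∧ x 2 < m * x 1}, ?_, ?_, ?_⟩⟩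
  · exact fun x ⟨h0, h1, h2, h3⟩ => ⟨h0.le, h1.le, h2.le, h3.le⟩
  · have hlt {f g : (Fin 3 → ℝ) → ℝ} (hf : Continuous f) (hg : Continuous g) :=
      isOpen_lt hf hg
    exact (hlt (by fun_prop) (by fun_prop)).inter ((hlt (by fun_prop) (by fun_prop)).inter
      ((hlt (by fun_prop) (by fun_prop)).inter (hlt (by fun_prop) (by fun_prop))))
  · have := mul_pos hm' hs'
    have : (![(s : ℝ) / 2, s / 2, m * (s / 4)] : Fin 3 → ℝ) 2 = m * (s / 4) := rfl
    simp only [Set.mem_ofPred_eq, Matrix.cons_val_zero, Matrix.cons_val_one, this]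
    refine ⟨?_, ?_, ?_, ?_⟩ <;> nlinarith

theorem smul_reeve (m : ℕ) (s : ℝ) {t : ℝ} (ht : 0 < t) : t • reeve m s = reeve m (t * s) := by
  ext x
  rw [Set.mem_smul_set_iff_inv_smul_mem₀ ht.ne']
  simp only [reeve, Set.mem_ofPred_eq, Pi.smul_apply, smul_eq_mul]
  have e1 : m * (t⁻¹ * x 0 + t⁻¹ * x 1 - s) = t⁻¹ * (m * (x 0 + x 1 - t * s)) := by
    field_simp
  rw [e1, mul_left_comm (m : ℝ), mul_left_comm (m : ℝ), mul_nonneg_iff_of_pos_left (inv_pos.2 ht),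
    mul_le_mul_iff_of_pos_left (inv_pos.2 ht), mul_le_mul_iff_of_pos_left (inv_pos.2 ht),
    mul_le_mul_iff_of_pos_left (inv_pos.2 ht)]

theorem ncard_integer_points_reeve {m : ℕ} (hm : 0 < m) (u : ℕ) :
    {x : Fin 3 → ℝ | x ∈ reeve m u ∧ ∀ i, ∃ z : ℤ, x i = z}.ncard =
      ∑ x ∈ Finset.range (u + 1), ∑ y ∈ Finset.range (u + 1),
        (m * min x y + 1 - m * (x + y - u)) := by
  let f : (Σ _ : ℕ × ℕ, ℕ) → Fin 3 → ℝ := fun q => ![q.1.1, q.1.2, q.2]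
  have hf : f.Injective := by
    rintro ⟨⟨x, y⟩, z⟩ ⟨⟨x', y'⟩, z'⟩ h
    have h0 := congrFun h 0
    have h1 := congrFun h 1
    have h2 := congrFun h 2
    simp [f] at h0 h1 h2
    simp [h0, h1, h2]
  have h : {x : Fin 3 → ℝ | x ∈ reeve m u ∧ ∀ i, ∃ z : ℤ, x i = z} =
      f '' ((Finset.range (u + 1) ×ˢ Finset.range (u + 1)).sigma
        fun q => Finset.Icc (m * (q.1 + q.2 - u)) (m * min q.1 q.2) : Finset (Σ _ : ℕ × ℕ, ℕ)) := by
    ext w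
    have hm' : (0 : ℝ) < m := Nat.cast_pos.2 hm
    simp only [Set.mem_ofPred_eq, Set.mem_image, Finset.mem_coe, Finset.mem_sigma,
      Finset.mem_product, Finset.mem_range, Finset.mem_Icc, reeve]
    constructor
    · rintro ⟨⟨h0, h1, h2, h3⟩, hz⟩
      obtain ⟨x, hx⟩ := hz 0
      obtain ⟨y, hy⟩ := hz 1
      obtain ⟨z, hz⟩ := hz 2
      rw [hx, hy, hz] at h1
      rw [hz] at h0
      rw [hz, hx] at h2
      rw [hz, hy] at h3
      norm_cast at h0 h1 h2 h3
      have hmz : (0 : ℤ) < m := by exact_mod_cast hm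
      have hx0 : 0 ≤ x := nonneg_of_mul_nonneg_right (h0.trans h2) hmz
      have hy0 : 0 ≤ y := nonneg_of_mul_nonneg_right (h0.trans h3) hmz
      lift x to ℕ using hx0
      lift y to ℕ using hy0
      lift z to ℕ using h0
      have hxu : (x : ℤ) + y - u ≤ x := le_of_mul_le_mul_left (h1.trans h2) hmz
      have hyu : (x : ℤ) + y - u ≤ y := le_of_mul_le_mul_left (h1.trans h3) hmz
      refine ⟨⟨(x, y), z⟩, ⟨⟨by simp; omega, by simp; omega⟩, ?_, ?_⟩, ?_⟩
      · rcases le_total (x + y) u with h | h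
        · simp [Nat.sub_eq_zero_of_le h]
        · zify [h]; exact h1
      · rcases le_total x y with h | h
        · simp only [min_eq_left h]; exact_mod_cast h2
        · simp only [min_eq_right h]; exact_mod_cast h3
      · ext i
        fin_cases i <;> simp [f, hx, hy, hz]
    · rintro ⟨⟨⟨x, y⟩, z⟩, ⟨⟨hx, hy⟩, h1, h2⟩, rfl⟩
      dsimp only at hx hy h1 h2
      simp only [f, Matrix.cons_val_zero, Matrix.cons_val_one, Matrix.cons_val]
      refine ⟨⟨Nat.cast_nonneg z, ?_, ?_, ?_⟩, ?_⟩
      · have : (x : ℝ) + y - u ≤ (x + y - u : ℕ) := by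
          rw [sub_le_iff_le_add]
          exact_mod_cast le_tsub_add
        exact (mul_le_mul_of_nonneg_left this hm'.le).trans (by exact_mod_cast h1)
      · exact_mod_cast h2.trans (Nat.mul_le_mul_left m (min_le_left x y))
      · exact_mod_cast h2.trans (Nat.mul_le_mul_left m (min_le_right x y))
      · intro i
        fin_cases i
        exacts [⟨x, by simp⟩, ⟨y, by simp⟩, ⟨z, by simp⟩]
  rw [h, Set.ncard_image_of_injective _ hf, Set.ncard_coe_finset, Finset.card_sigma,
    Finset.sum_product]
  simp only [Nat.card_Icc]

theorem sum_sum_min (u : ℕ) :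
    ∑ x ∈ Finset.range (u + 1), ∑ y ∈ Finset.range (u + 1), ((min x y : ℕ) : ℚ) =
      u * (u + 1) * (2 * u + 1) / 6 := by
  have hid (n : ℕ) : ∑ x ∈ Finset.range (n + 1), (x : ℚ) = n * (n + 1) / 2 := by
    induction n with
    | zero => simp
    | succ n ih => rw [Finset.sum_range_succ, ih]; push_cast; ring
  induction u with
  | zero => simp
  | succ u ih =>
    have h1 : ∑ y ∈ Finset.range (u + 1), ((min (u + 1) y : ℕ) : ℚ) =
        ∑ y ∈ Finset.range (u + 1), (y : ℚ) :=
      Finset.sum_congr rfl fun y hy => by rw [min_eq_right (Finset.mem_range.1 hy).le]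
    rw [Finset.sum_range_succ]
    simp only [Finset.sum_range_succ _ (u + 1), Finset.sum_add_distrib]
    simp only [min_comm _ (u + 1)]
    rw [ih, h1, hid, min_self]
    push_cast
    ring

theorem sum_sum_tsub (u : ℕ) :
    ∑ x ∈ Finset.range (u + 1), ∑ y ∈ Finset.range (u + 1), ((x + y - u : ℕ) : ℚ) =
      u * (u + 1) * (u + 2) / 6 := by
  have hr (u : ℕ) : ∑ y ∈ Finset.range (u + 1), ((u + 1 - y : ℕ) : ℚ) = (u + 1) * (u + 2) / 2 := by
    induction u with
    | zero => simp
    | succ u ih =>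
      rw [Finset.sum_range_succ']
      simp only [Nat.add_sub_add_right, ih]
      push_cast
      ring
  have h : ∑ x ∈ Finset.range (u + 1), ∑ y ∈ Finset.range (u + 1), ((x + y - u : ℕ) : ℚ) =
      ∑ x ∈ Finset.range (u + 1), ∑ y ∈ Finset.range (u + 1), ((x - y : ℕ) : ℚ) := by
    refine Finset.sum_congr rfl fun x _ => ?_
    rw [← Finset.sum_range_reflect]
    refine Finset.sum_congr rfl fun y hy => ?_
    have := Finset.mem_range.1 hy
    congr 1
    omega
  rw [h]
  clear h
  induction u with
  | zero => simp
  | succ u ih =>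
    have h1 : ∑ x ∈ Finset.range (u + 1), ((x - (u + 1) : ℕ) : ℚ) = 0 :=
      Finset.sum_eq_zero fun x hx => by
        rw [Nat.sub_eq_zero_of_le (Finset.mem_range.1 hx).le, Nat.cast_zero]
    rw [Finset.sum_range_succ]
    simp only [Finset.sum_range_succ _ (u + 1), Finset.sum_add_distrib]
    rw [ih, h1, hr, Nat.sub_self]
    push_cast
    ring

theorem ncard_integer_points_reeve_eq {m : ℕ} (hm : 0 < m) (u : ℕ) :
    ({x : Fin 3 → ℝ | x ∈ reeve m u ∧ ∀ i, ∃ z : ℤ, x i = z}.ncard : ℚ) =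
      m / 6 * ((u : ℚ) ^ 3 - u) + (u + 1) ^ 2 := by
  have h : ∑ x ∈ Finset.range (u + 1), ∑ y ∈ Finset.range (u + 1),
        ((m * min x y + 1 - m * (x + y - u) : ℕ) : ℚ) =
      ∑ x ∈ Finset.range (u + 1), ∑ y ∈ Finset.range (u + 1),
        (m * ((min x y : ℕ) : ℚ) + 1 - m * ((x + y - u : ℕ) : ℚ)) := by
    refine Finset.sum_congr rfl fun x hx => Finset.sum_congr rfl fun y hy => ?_
    have hx := Finset.mem_range.1 hx
    have hy := Finset.mem_range.1 hy
    have : m * (x + y - u) ≤ m * min x y := Nat.mul_le_mul_left m (by omega)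
    rw [Nat.cast_sub (by omega), Nat.cast_add, Nat.cast_mul, Nat.cast_mul,
      Nat.cast_one]
  rw [ncard_integer_points_reeve hm]
  push_cast only [Nat.cast_sum]
  rw [h]
  simp only [Finset.sum_sub_distrib, Finset.sum_add_distrib, ← Finset.mul_sum]
  rw [sum_sum_min, sum_sum_tsub]
  simp
  ring

theorem hasEhrhartPolynomial_reeve_two {m : ℕ} (hm : 0 < m) :
    HasEhrhartPolynomial (reeve m 2)
      (C (4 * m / 3 : ℚ) * X ^ 3 + C 4 * X ^ 2 + C (4 - m / 3 : ℚ) * X + 1) where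
  integral := by simpa using isIntegralPolytope_reeve hm two_pos
  interior_nonempty := by simpa using interior_reeve_nonempty hm two_pos
  count t ht := by
    have h := ncard_integer_points_reeve_eq hm (t * 2)
    rw [latticeCount, smul_reeve m 2 (Nat.cast_pos.2 ht)]
    push_cast at h
    rw [h]
    simp
    ring

theorem coeff_C_mul_X_add_one_pow (a : ℚ) (n k : ℕ) :
    ((C a * X + 1) ^ n).coeff k = n.choose k * a ^ k := by
  have h : (C a * X + 1 : ℚ[X]) ^ n = ((X + 1) ^ n).comp (C a * X) := by simp
  rw [h, comp_C_mul_X_coeff, coeff_X_add_one_pow]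

section CubicMul

variable (A B D : ℚ) (q : ℚ[X])

theorem cubic_mul_eq : (C A * X ^ 3 + C B * X ^ 2 + C D * X + 1) * q =
    C A * (q * X ^ 3) + C B * (q * X ^ 2) + C D * (q * X) + q := by
  ring

theorem coeff_cubic_mul_zero :
    ((C A * X ^ 3 + C B * X ^ 2 + C D * X + 1) * q).coeff 0 = q.coeff 0 := by
  rw [cubic_mul_eq]
  simp

theorem coeff_cubic_mul_one :
    ((C A * X ^ 3 + C B * X ^ 2 + C D * X + 1) * q).coeff 1 = D * q.coeff 0 + q.coeff 1 := by
  rw [cubic_mul_eq]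
  simp [coeff_mul_X_pow']

theorem coeff_cubic_mul_two :
    ((C A * X ^ 3 + C B * X ^ 2 + C D * X + 1) * q).coeff 2 =
      B * q.coeff 0 + D * q.coeff 1 + q.coeff 2 := by
  rw [cubic_mul_eq]
  simp [coeff_mul_X_pow', coeff_mul_X]

theorem coeff_cubic_mul_add_three (k : ℕ) :
    ((C A * X ^ 3 + C B * X ^ 2 + C D * X + 1) * q).coeff (k + 3) =
      A * q.coeff k + B * q.coeff (k + 1) + D * q.coeff (k + 2) + q.coeff (k + 3) := by
  rw [cubic_mul_eq]
  simp [coeff_mul_X_pow', coeff_mul_X]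

end CubicMul

/-- The Ehrhart polynomial of the product of `reeve m 2` with the cube `[0, a] ^ n`. -/
noncomputable def reevePrismPoly (m a n : ℕ) : ℚ[X] :=
  (C (4 * m / 3 : ℚ) * X ^ 3 + C 4 * X ^ 2 + C (4 - m / 3 : ℚ) * X + 1) *
    (C (a : ℚ) * X + 1) ^ n

theorem natDegree_reevePrismPoly {m a : ℕ} (hm : 0 < m) (ha : 0 < a) (n : ℕ) :
    (reevePrismPoly m a n).natDegree = 3 + n := by
  have hA : (4 * m / 3 : ℚ) ≠ 0 := by positivity
  have ha' : (a : ℚ) ≠ 0 := by positivity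
  have h3 : (C (4 * m / 3 : ℚ) * X ^ 3 + C 4 * X ^ 2 + C (4 - m / 3 : ℚ) * X + 1).natDegree = 3 := by
    rw [← C_1]
    exact natDegree_cubic hA
  have h1 : (C (a : ℚ) * X + 1).natDegree = 1 := by
    rw [← C_1]
    exact natDegree_linear ha'
  rw [reevePrismPoly, natDegree_mul, natDegree_pow, h3, h1, mul_one]
  · exact ne_zero_of_natDegree_gt (n := 0) (by omega)
  · exact pow_ne_zero _ (ne_zero_of_natDegree_gt (n := 0) (by omega))

theorem coeff_zero_reevePrismPoly (m a n : ℕ) : (reevePrismPoly m a n).coeff 0 = 1 := by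
  rw [reevePrismPoly, coeff_cubic_mul_zero, coeff_C_mul_X_add_one_pow]
  simp

theorem coeff_reevePrismPoly_pos {n : ℕ} (hn : 0 < n) :
    0 < (reevePrismPoly (6 * n ^ 2 + 12) n n).coeff (n + 1) := by
  obtain ⟨n, rfl⟩ := Nat.exists_eq_succ_of_ne_zero hn.ne'
  rcases n with _ | k
  · rw [reevePrismPoly, coeff_cubic_mul_two]
    simp only [coeff_C_mul_X_add_one_pow]
    norm_num
  · rw [reevePrismPoly, coeff_cubic_mul_add_three]
    simp only [coeff_C_mul_X_add_one_pow, Nat.succ_eq_add_one]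
    have h0 : ((k + 1 + 1).choose k : ℚ) = (k + 2) * (k + 1) / 2 := by
      rw [Nat.choose_symm_of_eq_add (show k + 1 + 1 = k + 2 by rfl), Nat.cast_choose_two]
      push_cast
      ring
    have h1 : (k + 1 + 1).choose (k + 1) = k + 2 := Nat.choose_succ_self_right (k + 1)
    have h3 : (k + 1 + 1).choose (k + 3) = 0 := Nat.choose_eq_zero_of_lt (by omega)
    rw [h0, h1, h3, Nat.choose_self]
    push_cast
    have hk : (0 : ℚ) ≤ k := Nat.cast_nonneg k
    refine lt_of_lt_of_eq (mul_pos (pow_pos (show (0 : ℚ) < k + 1 + 1 by positivity) k)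
      (show (0 : ℚ) < 2 * k ^ 4 + 12 * k ^ 3 + 36 * k ^ 2 + 56 * k + 32 by positivity)) ?_
    ring

theorem coeff_reevePrismPoly_neg {n j : ℕ} (hj : 0 < j) (hjn : j ≤ n) :
    (reevePrismPoly (6 * n ^ 2 + 12) n n).coeff j < 0 := by
  have hn : (1 : ℚ) ≤ n := by exact_mod_cast hj.trans_le hjn
  obtain rfl | rfl | ⟨k, rfl⟩ : j = 1 ∨ j = 2 ∨ ∃ k, j = k + 3 := by
    rcases j with _ | _ | _ | k <;> simp at hj ⊢
  · rw [reevePrismPoly, coeff_cubic_mul_one]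
    simp only [coeff_C_mul_X_add_one_pow, Nat.choose_zero_right, Nat.choose_one_right]
    push_cast
    nlinarith
  · rw [reevePrismPoly, coeff_cubic_mul_two]
    simp only [coeff_C_mul_X_add_one_pow, Nat.choose_zero_right, Nat.choose_one_right,
      Nat.cast_choose_two]
    push_cast
    have hn2 : (2 : ℚ) ≤ n := by exact_mod_cast hjn
    have : (2 : ℚ) ^ 4 ≤ n ^ 4 := by gcongr
    have : (0 : ℚ) ≤ n ^ 3 := by positivity
    nlinarith
  · rw [reevePrismPoly, coeff_cubic_mul_add_three]
    simp only [coeff_C_mul_X_add_one_pow]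
    have r1 : (n.choose (k + 1) : ℚ) * (k + 1) = n.choose k * (n - k) := by
      have := Nat.choose_succ_right_eq n k
      rw [← Nat.cast_sub (by omega)]
      exact_mod_cast this
    have r2 : (n.choose (k + 2) : ℚ) * (k + 2) = n.choose (k + 1) * (n - (k + 1)) := by
      have := Nat.choose_succ_right_eq n (k + 1)
      have e : ((n - (k + 1) : ℕ) : ℚ) = n - (k + 1) := by rw [Nat.cast_sub (by omega)]; simp
      rw [← e]
      exact_mod_cast this
    have r3 : (n.choose (k + 3) : ℚ) * (k + 3) = n.choose (k + 2) * (n - (k + 2)) := by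
      have := Nat.choose_succ_right_eq n (k + 2)
      have e : ((n - (k + 2) : ℕ) : ℚ) = n - (k + 2) := by rw [Nat.cast_sub (by omega)]; simp
      rw [← e]
      exact_mod_cast this
    have hY : (0 : ℚ) < n.choose (k + 2) := by exact_mod_cast Nat.choose_pos (by omega)
    have h0 : (0 : ℚ) ≤ n.choose k := Nat.cast_nonneg _
    have h1 : (0 : ℚ) ≤ n.choose (k + 1) := Nat.cast_nonneg _
    have h3 : (0 : ℚ) ≤ n.choose (k + 3) := Nat.cast_nonneg _
    have hk : (0 : ℚ) ≤ k := Nat.cast_nonneg k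
    have hkn : (k : ℚ) + 3 ≤ n := by exact_mod_cast hjn
    generalize (n.choose k : ℚ) = c0 at *
    generalize (n.choose (k + 1) : ℚ) = c1 at *
    generalize (n.choose (k + 2) : ℚ) = Y at *
    generalize (n.choose (k + 3) : ℚ) = c3 at *
    push_cast
    have b3 : 2 * c3 ≤ Y * (n - 1) := by nlinarith
    have b1 : 2 * c1 ≤ Y * (n - 1) := by nlinarith
    have b0 : 3 * c0 ≤ c1 * (n - 2) := by nlinarith
    have b0' : 6 * c0 ≤ Y * ((n - 1) * (n - 2)) := by nlinarith
    generalize (n : ℚ) = x at *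
    have hx : 3 ≤ x := by linarith
    have key : 8 * (x ^ 2 + 2) * c0 + 4 * x * c1 - 2 * x ^ 4 * Y + x ^ 3 * c3 < 0 := by
      have e0 := mul_le_mul_of_nonneg_left b0' (show 0 ≤ 8 * (x ^ 2 + 2) by positivity)
      have e1 := mul_le_mul_of_nonneg_left b1 (show 0 ≤ 12 * x by positivity)
      have e3 := mul_le_mul_of_nonneg_left b3 (show 0 ≤ 3 * x ^ 3 by positivity)
      have hq : 0 < x ^ 4 + 27 * x ^ 3 - 44 * x ^ 2 + 60 * x - 32 := by
        nlinarith [pow_pos (show 0 < x by linarith) 4, pow_pos (show 0 < x by linarith) 2,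
          mul_nonneg (sq_nonneg x) (sub_nonneg.2 hx)]
      have := mul_pos hY hq
      linarith
    refine lt_of_eq_of_lt ?_ (mul_neg_of_pos_of_neg (pow_pos (show 0 < x by linarith) k) key)
    ring

theorem HasEhrhartPolynomial.affineSpan_eq_top {N : ℕ} {P : Set (Fin N → ℝ)} {p : ℚ[X]}
    (h : HasEhrhartPolynomial P p) : affineSpan ℝ P = ⊤ :=
  top_unique ((isOpen_interior.affineSpan_eq_top h.interior_nonempty).ge.trans
    (affineSpan_mono ℝ interior_subset))

theorem one_positive (d : ℕ) (hd : 3 ≤ d) :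
    ∃ (P : Set (Fin d → ℝ)) (p : Polynomial ℚ),
      IsIntegralPolytope P ∧ affineSpan ℝ P = ⊤ ∧
      p.natDegree = d ∧ p.coeff 0 = 1 ∧
      (∀ t : ℕ, 0 < t → (latticeCount P t : ℚ) = p.eval (t : ℚ)) ∧
      0 < p.coeff (d - 2) ∧
      (∀ j : ℕ, 1 ≤ j → j < d - 2 → p.coeff j < 0) := by
  obtain ⟨n, rfl⟩ := Nat.exists_eq_add_of_le hd
  have hsub : 3 + n - 2 = n + 1 := by omega
  rw [hsub]
  rcases Nat.eq_zero_or_pos n with rfl | hn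
  · obtain ⟨P, hP⟩ := (hasEhrhartPolynomial_reeve_two (m := 6) (by norm_num)).exists_mul_pow
      one_pos 0
    refine ⟨P, reevePrismPoly 6 1 0, hP.integral, hP.affineSpan_eq_top,
      natDegree_reevePrismPoly (by norm_num) one_pos 0, coeff_zero_reevePrismPoly _ _ _,
      hP.count, ?_, fun j hj hj' => by omega⟩
    rw [reevePrismPoly, coeff_cubic_mul_one]
    norm_num [coeff_one]
  · have hm : 0 < 6 * n ^ 2 + 12 := by positivity
    obtain ⟨P, hP⟩ := (hasEhrhartPolynomial_reeve_two hm).exists_mul_pow hn n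
    exact ⟨P, reevePrismPoly (6 * n ^ 2 + 12) n n, hP.integral, hP.affineSpan_eq_top,
      natDegree_reevePrismPoly hm hn n, coeff_zero_reevePrismPoly _ _ _, hP.count,
      coeff_reevePrismPoly_pos hn,
      fun j hj hj' => coeff_reevePrismPoly_neg hj (Nat.lt_succ_iff.1 hj')⟩
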